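/- arXiv:2312.01754 — 4 statements merged into one kernel-verified Lean document; each statement's English description precedes it below -/
import Mathlib

section
/- Let e1, e2 : (0,∞) × ℝ → ℝ be differentiable with phasic pressures p_k(τ,s) = −∂e_k/∂τ(τ,s) (k = 1,2), and let ei : ℝ → ℝ be differentiable with interfacial temperature T_i(s) = ei'(s) and surface tension γ_i(s) = ei(s) − s·T_i(s). Define the fluid–interface specific energy e(ρ, s, s1, s2, a, y, α) = y·e1(α/(yρ), s1) + (1−y)·e2((1−α)/((1−y)ρ), s2) + (a/ρ)·ei(ρ(s − y·s1 − (1−y)·s2)/a). Then for all ρ, a > 0, y, α ∈ (0,1), s, s1, s2 ∈ ℝ: ρ²·∂e/∂ρ = α·p1(α/(yρ), s1) + (1−α)·p2((1−α)/((1−y)ρ), s2) − a·γ_i(s_i), where s_i = ρ(s − y·s1 − (1−y)·s2)/a. In other words, the thermodynamic pressure generated by e is the mixture pressure p = α p1 + (1−α) p2 − a γ_i. -/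
/-- Phasic pressure `p_k(τ,s) = −∂e_k/∂τ(τ,s)`. -/
noncomputable def pres (e : ℝ × ℝ → ℝ) (τ s : ℝ) : ℝ :=
  -(fderiv ℝ e (τ, s) (1, 0))

/-- Surface tension `γ_i(s) = ei(s) − s·ei'(s)`. -/
noncomputable def gam (ei : ℝ → ℝ) (s : ℝ) : ℝ := ei s - s * deriv ei s

/-- The fluid–interface specific internal energy. -/
noncomputable def emix (e1 e2 : ℝ × ℝ → ℝ) (ei : ℝ → ℝ)
    (ρ s s1 s2 a y α : ℝ) : ℝ :=
  y * e1 (α / (y * ρ), s1) + (1 - y) * e2 ((1 - α) / ((1 - y) * ρ), s2)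
    + (a / ρ) * ei (ρ * (s - y * s1 - (1 - y) * s2) / a)

/-- The contribution of one phase, of mass fraction `c` and volume fraction `β`, to `∂e/∂ρ`. -/
theorem hasDerivAt_phase {e : ℝ × ℝ → ℝ}
    (he : DifferentiableOn ℝ e {p : ℝ × ℝ | 0 < p.1}) {c β ρ : ℝ} (s : ℝ)
    (hc : 0 < c) (hβ : 0 < β) (hρ : 0 < ρ) :
    HasDerivAt (fun r => c * e (β / (c * r), s)) (β * pres e (β / (c * ρ)) s / ρ ^ 2) ρ := by
  have hτ : 0 < β / (c * ρ) := by positivity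
  have hopen : IsOpen {p : ℝ × ℝ | 0 < p.1} := isOpen_lt continuous_const continuous_fst
  have hd : HasFDerivAt e (fderiv ℝ e (β / (c * ρ), s)) (β / (c * ρ), s) :=
    (he.differentiableAt (hopen.mem_nhds hτ)).hasFDerivAt
  have hvol : HasDerivAt (fun r => β / (c * r)) (-(β / (c * ρ ^ 2))) ρ := by
    refine ((hasDerivAt_const ρ β).fun_div ((hasDerivAt_id' ρ).const_mul c)
      (mul_pos hc hρ).ne').congr_deriv ?_
    field_simp
    ring
  have h := (hd.comp_hasDerivAt ρ (hvol.prodMk (hasDerivAt_const ρ s))).const_mul c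
  refine h.congr_deriv ?_
  have hv : ((-(β / (c * ρ ^ 2)), 0) : ℝ × ℝ) = (-(β / (c * ρ ^ 2))) • ((1, 0) : ℝ × ℝ) := by
    simp
  rw [hv, map_smul, pres, smul_eq_mul]
  field_simp

/-- The contribution of the interface to `∂e/∂ρ`, for an interfacial entropy `ρ * σ / a`. -/
theorem hasDerivAt_interface {ei : ℝ → ℝ} (hei : Differentiable ℝ ei) {a ρ : ℝ} (σ : ℝ)
    (ha : a ≠ 0) (hρ : ρ ≠ 0) :
    HasDerivAt (fun r => (a / r) * ei (r * σ / a)) (-(a * gam ei (ρ * σ / a)) / ρ ^ 2) ρ := by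
  have hs : HasDerivAt (fun r => r * σ / a) (σ / a) ρ := by
    simpa using ((hasDerivAt_id ρ).mul_const σ).div_const a
  have hq : HasDerivAt (fun r => a / r) (-a / ρ ^ 2) ρ := by
    simpa using (hasDerivAt_const ρ a).fun_div (hasDerivAt_id' ρ) hρ
  refine (hq.mul ((hei _).hasDerivAt.comp ρ hs)).congr_deriv ?_
  simp only [gam, Function.comp_apply]
  field_simp
  ring

theorem stmt8 (e1 e2 : ℝ × ℝ → ℝ) (ei : ℝ → ℝ)
    (he1 : DifferentiableOn ℝ e1 {p : ℝ × ℝ | 0 < p.1})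
    (he2 : DifferentiableOn ℝ e2 {p : ℝ × ℝ | 0 < p.1})
    (hei : Differentiable ℝ ei)
    (ρ s s1 s2 a y α : ℝ) (hρ : 0 < ρ) (ha : 0 < a)
    (hy : y ∈ Set.Ioo (0 : ℝ) 1) (hα : α ∈ Set.Ioo (0 : ℝ) 1) :
    -- ρ²·∂e/∂ρ = α·p1 + (1−α)·p2 − a·γ_i(s_i)
    ρ ^ 2 * deriv (fun ρ' => emix e1 e2 ei ρ' s s1 s2 a y α) ρ
      = α * pres e1 (α / (y * ρ)) s1
        + (1 - α) * pres e2 ((1 - α) / ((1 - y) * ρ)) s2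
        - a * gam ei (ρ * (s - y * s1 - (1 - y) * s2) / a) := by
  have h := ((hasDerivAt_phase he1 s1 hy.1 hα.1 hρ).add
    (hasDerivAt_phase he2 s2 (sub_pos.2 hy.2) (sub_pos.2 hα.2) hρ)).add
    (hasDerivAt_interface hei (s - y * s1 - (1 - y) * s2) ha.ne' hρ.ne')
  have hderiv : deriv (fun ρ' => emix e1 e2 ei ρ' s s1 s2 a y α) ρ = _ := h.deriv
  rw [hderiv]
  field_simp
  ring
end

section
/- Let e1, e2 : (0,∞) × ℝ → ℝ be differentiable with p_k(τ,s) = −∂e_k/∂τ(τ,s) (k=1,2), let ei : ℝ → ℝ be differentiable with T_i(s) = ei'(s) and γ_i(s) = ei(s) − s·T_i(s), and let m, ν > 0 be constants. Define e(ρ, s, s1, s2, a, y, α) = y·e1(α/(yρ), s1) + (1−y)·e2((1−α)/((1−y)ρ), s2) + (a/ρ)·ei(ρ(s − y·s1 − (1−y)·s2)/a), and the Lagrangian L(ρ, s, s1, s2, a, y, α, u, ξ, η) = ρ·u²/2 + m·ξ²/2 + ν·η²/2 − ρ·e(ρ, s, s1, s2, a, y, α). Then for all ρ, a > 0, y, α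 ∈ (0,1), s, s1, s2, u, ξ, η ∈ ℝ, the partial Legendre transform of L with respect to ρ satisfies: ρ·∂L/∂ρ − L = −( m·ξ²/2 + ν·η²/2 + p ), where p = α·p1(α/(yρ), s1) + (1−α)·p2((1−α)/((1−y)ρ), s2) − a·γ_i(s_i) and s_i = ρ(s − y·s1 − (1−y)·s2)/a. -/
/-- The Lagrangian `L = ρu²/2 + mξ²/2 + νη²/2 − ρe`. -/
noncomputable def Lag (e1 e2 : ℝ × ℝ → ℝ) (ei : ℝ → ℝ) (m ν : ℝ)
    (ρ s s1 s2 a y α u ξ η : ℝ) : ℝ :=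
  ρ * u ^ 2 / 2 + m * ξ ^ 2 / 2 + ν * η ^ 2 / 2
    - ρ * emix e1 e2 ei ρ s s1 s2 a y α

/-- Derivative in the density of a phasic energy evaluated at the specific volume `b / (c ρ)`. -/
theorem hasDerivAt_phasic_energy {e : ℝ × ℝ → ℝ}
    (he : DifferentiableOn ℝ e {p : ℝ × ℝ | 0 < p.1}) {b c ρ : ℝ} (σ : ℝ)
    (hb : 0 < b) (hc : 0 < c) (hρ : 0 < ρ) :
    HasDerivAt (fun r => e (b / (c * r), σ))
      (b / (c * ρ ^ 2) * pres e (b / (c * ρ)) σ) ρ := by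
  have hmem : {p : ℝ × ℝ | 0 < p.1} ∈ nhds (b / (c * ρ), σ) :=
    (isOpen_lt continuous_const continuous_fst).mem_nhds
      (show 0 < b / (c * ρ) by positivity)
  have hτ : HasDerivAt (fun r : ℝ => b / (c * r)) (-(b / (c * ρ ^ 2))) ρ := by
    have h := (hasDerivAt_const ρ b).div ((hasDerivAt_id ρ).const_mul c)
      (by simpa using ⟨hc.ne', hρ.ne'⟩)
    refine h.congr_deriv ?_
    simp only [id]
    field_simp
    ring
  have h := (he.differentiableAt hmem).hasFDerivAt.comp_hasDerivAt ρ
    (hτ.prodMk (hasDerivAt_const ρ σ))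
  refine h.congr_deriv ?_
  have hv : ((-(b / (c * ρ ^ 2)), 0) : ℝ × ℝ) = (-(b / (c * ρ ^ 2))) • ((1, 0) : ℝ × ℝ) := by
    simp
  rw [hv, map_smul, pres, smul_eq_mul]
  ring

/-- Derivative in the density of the interfacial contribution to the specific energy. -/
theorem hasDerivAt_interface_energy {ei : ℝ → ℝ} (hei : Differentiable ℝ ei)
    {a ρ : ℝ} (c : ℝ) (ha : 0 < a) (hρ : 0 < ρ) :
    HasDerivAt (fun r => a / r * ei (r * c / a))
      (-(a / ρ ^ 2) * gam ei (ρ * c / a)) ρ := by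
  have hs : HasDerivAt (fun r : ℝ => r * c / a) (c / a) ρ := by
    simpa using ((hasDerivAt_id ρ).mul_const c).div_const a
  have hr : HasDerivAt (fun r : ℝ => a / r) (-(a / ρ ^ 2)) ρ := by
    refine ((hasDerivAt_const ρ a).div (hasDerivAt_id ρ) hρ.ne').congr_deriv ?_
    simp only [id]
    field_simp
    ring
  refine (hr.mul ((hei (ρ * c / a)).hasDerivAt.comp ρ hs)).congr_deriv ?_
  simp only [gam, Function.comp]
  field_simp
  ring

theorem stmt11 (e1 e2 : ℝ × ℝ → ℝ) (ei : ℝ → ℝ)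
    (he1 : DifferentiableOn ℝ e1 {p : ℝ × ℝ | 0 < p.1})
    (he2 : DifferentiableOn ℝ e2 {p : ℝ × ℝ | 0 < p.1})
    (hei : Differentiable ℝ ei)
    (m ν : ℝ) (hm : 0 < m) (hν : 0 < ν)
    (ρ s s1 s2 a y α u ξ η : ℝ) (hρ : 0 < ρ) (ha : 0 < a)
    (hy : y ∈ Set.Ioo (0 : ℝ) 1) (hα : α ∈ Set.Ioo (0 : ℝ) 1) :
    -- ρ·∂L/∂ρ − L = −(mξ²/2 + νη²/2 + p)
    ρ * deriv (fun ρ' => Lag e1 e2 ei m ν ρ' s s1 s2 a y α u ξ η) ρ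
        - Lag e1 e2 ei m ν ρ s s1 s2 a y α u ξ η
      = -(m * ξ ^ 2 / 2 + ν * η ^ 2 / 2
          + (α * pres e1 (α / (y * ρ)) s1
            + (1 - α) * pres e2 ((1 - α) / ((1 - y) * ρ)) s2
            - a * gam ei (ρ * (s - y * s1 - (1 - y) * s2) / a))) := by
  obtain ⟨hy0, hy1⟩ := hy
  obtain ⟨hα0, hα1⟩ := hα
  have hy' : 0 < 1 - y := sub_pos.2 hy1
  have h1 := hasDerivAt_phasic_energy he1 s1 hα0 hy0 hρ
  have h2 := hasDerivAt_phasic_energy he2 s2 (sub_pos.2 hα1) hy' hρ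
  have h3 := hasDerivAt_interface_energy hei (s - y * s1 - (1 - y) * s2) ha hρ
  have he : HasDerivAt (fun r => emix e1 e2 ei r s s1 s2 a y α) _ ρ :=
    ((h1.const_mul y).add (h2.const_mul (1 - y))).add h3
  have hL : HasDerivAt (fun r => Lag e1 e2 ei m ν r s s1 s2 a y α u ξ η) _ ρ :=
    (((((hasDerivAt_id ρ).mul_const (u ^ 2)).div_const 2).add_const
      (m * ξ ^ 2 / 2)).add_const (ν * η ^ 2 / 2)).sub ((hasDerivAt_id ρ).mul he)
  rw [hL.deriv]
  simp only [Lag, id]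
  generalize emix e1 e2 ei ρ s s1 s2 a y α = E
  generalize pres e1 _ _ = P1
  generalize pres e2 _ _ = P2
  generalize gam ei _ = G
  have hy'' := hy'.ne'
  field_simp
  ring
end

section
/- Let ei : ℝ → ℝ be C¹ with interfacial temperature T_i(s) = ei'(s) and surface tension γ_i(s) = ei(s) − s·T_i(s). Let a, σ, u, h : ℝ × ℝ → ℝ be C¹ functions of (t,x) with a > 0 everywhere, satisfying the conservation law ∂_t σ + ∂_x(σ·u) = 0 and the evolution equation ∂_t a + u·∂_x a = h. Set s_i := σ/a. Then the interfacial energy satisfies the evolution equation ∂_t(a·ei(s_i)) + ∂_x(a·ei(s_i)·u) − a·γ_i(s_i)·∂_x u = γ_i(s_i)·h. -/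
/-- Partial derivative in time of a field on `ℝ × ℝ` (coordinates `(t,x)`). -/
noncomputable def pt (f : ℝ × ℝ → ℝ) (p : ℝ × ℝ) : ℝ := fderiv ℝ f p (1, 0)

/-- Partial derivative in space of a field on `ℝ × ℝ` (coordinates `(t,x)`). -/
noncomputable def px (f : ℝ × ℝ → ℝ) (p : ℝ × ℝ) : ℝ := fderiv ℝ f p (0, 1)

/-- Gibbs relation for the energy per unit volume: `d(a·ei(σ/a)) = γ_i da + T_i dσ`. -/
theorem hasFDerivAt_mul_comp_div {E : Type*} [NormedAddCommGroup E] [NormedSpace ℝ E]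
    {ei : ℝ → ℝ} {a σ : E → ℝ} {a' σ' : E →L[ℝ] ℝ} {p : E}
    (hei : DifferentiableAt ℝ ei (σ p / a p)) (ha : HasFDerivAt a a' p)
    (hσ : HasFDerivAt σ σ' p) (hp : a p ≠ 0) :
    HasFDerivAt (fun q => a q * ei (σ q / a q))
      (gam ei (σ p / a p) • a' + deriv ei (σ p / a p) • σ') p := by
  have hinv := (hasDerivAt_inv hp).comp_hasFDerivAt p ha
  have hs : HasFDerivAt (fun q => σ q / a q) _ p := hσ.mul hinv
  refine (ha.mul (hei.hasDerivAt.comp_hasFDerivAt p hs)).congr_fderiv ?_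
  ext v
  simp [gam]
  field_simp
  ring

theorem px_mul {f g : ℝ × ℝ → ℝ} {p : ℝ × ℝ} (hf : DifferentiableAt ℝ f p)
    (hg : DifferentiableAt ℝ g p) :
    px (fun q => f q * g q) p = px f p * g p + f p * px g p := by
  simp [px, fderiv_fun_mul hf hg]
  ring

theorem stmt14 (ei : ℝ → ℝ) (hei : ContDiff ℝ 1 ei)
    (a σ u h : ℝ × ℝ → ℝ)
    (hac : ContDiff ℝ 1 a) (hσc : ContDiff ℝ 1 σ)
    (huc : ContDiff ℝ 1 u) (hhc : ContDiff ℝ 1 h)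
    (hapos : ∀ p, 0 < a p)
    (hσeq : ∀ p, pt σ p + px (fun q => σ q * u q) p = 0)
    (haeq : ∀ p, pt a p + u p * px a p = h p) :
    -- ∂_t(a·ei(s_i)) + ∂_x(a·ei(s_i)·u) − a·γ_i(s_i)·∂_x u = γ_i(s_i)·h
    ∀ p, pt (fun q => a q * ei (σ q / a q)) p
      + px (fun q => a q * ei (σ q / a q) * u q) p
      - a p * gam ei (σ p / a p) * px u p
      = gam ei (σ p / a p) * h p := by
  intro p
  have ha := (hac.differentiable one_ne_zero).differentiableAt (x := p)
  have hσ := (hσc.differentiable one_ne_zero).differentiableAt (x := p)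
  have hu := (huc.differentiable one_ne_zero).differentiableAt (x := p)
  have hp := (hapos p).ne'
  have hE := hasFDerivAt_mul_comp_div (hei.differentiable one_ne_zero).differentiableAt
    ha.hasFDerivAt hσ.hasFDerivAt hp
  have hEt : pt (fun q => a q * ei (σ q / a q)) p
      = gam ei (σ p / a p) * pt a p + deriv ei (σ p / a p) * pt σ p := by
    simp [pt, hE.fderiv]
  have hEx : px (fun q => a q * ei (σ q / a q)) p
      = gam ei (σ p / a p) * px a p + deriv ei (σ p / a p) * px σ p := by
    simp [px, hE.fderiv]
  have hEuler : a p * ei (σ p / a p)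
      = a p * gam ei (σ p / a p) + σ p * deriv ei (σ p / a p) := by
    simp only [gam]
    field_simp
    ring
  have hcons := hσeq p
  rw [px_mul hσ hu] at hcons
  rw [px_mul hE.differentiableAt hu, hEt, hEx]
  linear_combination gam ei (σ p / a p) * haeq p + deriv ei (σ p / a p) * hcons
    + px u p * hEuler
end

section
/- Let u, ρ, b ∈ ℝ and v : Fin 8 → ℝ, and let C be the 10 × 10 real matrix (indices 0,…,9) defined by: C 0 0 = u, C 0 1 = ρ, C 0 j = 0 for j ≥ 2; C 1 0 = b, C 1 1 = u, C 1 (j+2) = v j for j ∈ Fin 8; and C i j = u if i = j and 0 otherwise, for i ≥ 2. Then the characteristic polynomial of C equals (X − u)⁸ · ((X − u)² − ρ·b). -/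
/-- The 10×10 convection matrix of the quasilinear two-phase flow system. -/
noncomputable def Cmat (u ρ b : ℝ) (v : Fin 8 → ℝ) : Matrix (Fin 10) (Fin 10) ℝ :=
  Matrix.of fun i j =>
    if i = 0 then (if j = 0 then u else if j = 1 then ρ else 0)
    else if i = 1 then
      (if j = 0 then b else if j = 1 then u else v ⟨j.val - 2, by omega⟩)
    else (if i = j then u else 0)

/-- Split along `Fin 10 ≃ Fin 2 ⊕ Fin 8`, the convection matrix is block upper triangular. -/
theorem Cmat_eq_reindex_fromBlocks (u ρ b : ℝ) (v : Fin 8 → ℝ) :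
    Cmat u ρ b v = Matrix.reindex (finSumFinEquiv (m := 2) (n := 8)) finSumFinEquiv
      (Matrix.fromBlocks !![u, ρ; b, u] (Matrix.of ![0, v]) 0 (Matrix.diagonal fun _ => u)) := by
  rw [← Equiv.symm_apply_eq]
  ext i j
  rcases i with i | i <;> rcases j with j | j <;>
    fin_cases i <;> fin_cases j <;> rfl

theorem stmt15 (u ρ b : ℝ) (v : Fin 8 → ℝ) :
    (Cmat u ρ b v).charpoly
      = (Polynomial.X - Polynomial.C u) ^ 8
        * ((Polynomial.X - Polynomial.C u) ^ 2 - Polynomial.C (ρ * b)) := by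
  rw [Cmat_eq_reindex_fromBlocks, Matrix.charpoly_reindex, Matrix.charpoly_fromBlocks_zero₂₁,
    Matrix.charpoly_diagonal, Matrix.charpoly_fin_two]
  simp [Matrix.trace_fin_two, Matrix.det_fin_two]
  ring
end
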